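/- Let G be a finite group and m ≥ 1. The number of conjugacy classes of the wreath product G ≀ S_m equals the number of functions f : {1, …, m} × ConjClasses(G) → ℕ satisfying Σ_{(k,c)} k · f(k, c) = m. -/

import Mathlib

def permMulAut (G : Type*) [Group G] (t : ℕ) :
    Equiv.Perm (Fin t) →* MulAut (Fin t → G) where
  toFun σ :=
    { toFun := fun h i => h (σ⁻¹ i)
      invFun := fun h i => h (σ i)
      left_inv := fun h => by funext i; simp
      right_inv := fun h => by funext i; simp
      map_mul' := fun h g => rfl }
  map_one' := by ext h i; simp
  map_mul' := fun σ τ => by ext h i; simp [mul_inv_rev]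

/-- The wreath product `G ≀ S_t`, i.e. the semidirect product
`(Fin t → G) ⋊ Equiv.Perm (Fin t)`. -/
abbrev Wreath (G : Type*) [Group G] (t : ℕ) : Type _ :=
  SemidirectProduct (Fin t → G) (Equiv.Perm (Fin t)) (permMulAut G t)


namespace WreathAux

open Equiv Function

/-- Gluing lemma for group actions. -/
lemma exists_equiv {K X Y I : Type*} [Group K] (ρ : K →* Perm X) (ρ' : K →* Perm Y)
    (x : I → X) (y : I → Y)
    (hx : ∀ z, ∃ i k, ρ k (x i) = z) (hx' : ∀ i j k, ρ k (x i) = x j → i = j)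
    (hy : ∀ z, ∃ i k, ρ' k (y i) = z) (hy' : ∀ i j k, ρ' k (y i) = y j → i = j)
    (hst : ∀ i k, ρ k (x i) = x i ↔ ρ' k (y i) = y i) :
    ∃ Φ : X ≃ Y, ∀ k z, Φ (ρ k z) = ρ' k (Φ z) := by
  have aux : ∀ {Z : Type _} (r : K →* Perm Z) (k l : K) (a b : Z),
      r k a = r l b ↔ r (l⁻¹ * k) a = b := by
    intro Z r k l a b
    rw [map_mul, map_inv, Perm.mul_apply, Perm.inv_eq_iff_eq]
  have aux' : ∀ {Z : Type _} (r : K →* Perm Z) (k l : K) (a b : Z),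
      r k a = r l b ↔ r (l⁻¹ * k) a = b := by
    intro Z r k l a b
    rw [map_mul, map_inv, Perm.mul_apply, Perm.inv_eq_iff_eq]
  have key : ∀ i j k l, ρ k (x i) = ρ l (x j) ↔ ρ' k (y i) = ρ' l (y j) := by
    intro i j k l
    rw [aux, aux']
    constructor
    · intro h
      obtain rfl := hx' _ _ _ h
      exact (hst _ _).1 h
    · intro h
      obtain rfl := hy' _ _ _ h
      exact (hst _ _).2 h
  choose i k hik using hx
  have hΦ : ∀ j l, ρ' (k (ρ l (x j))) (y (i (ρ l (x j)))) = ρ' l (y j) := by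
    intro j l
    rw [← key]
    exact hik _
  refine ⟨Equiv.ofBijective (fun z => ρ' (k z) (y (i z))) ⟨?_, ?_⟩, ?_⟩
  · intro a b hab
    have := (key _ _ _ _).2 hab
    rwa [hik, hik] at this
  · intro b
    obtain ⟨j, l, rfl⟩ := hy b
    exact ⟨ρ l (x j), hΦ j l⟩
  · intro l z
    have := hΦ (i z) (l * k z)
    simp only [map_mul, Perm.mul_apply, hik] at this
    exact this

variable {G : Type*} [Group G] {m : ℕ}

lemma mul_left_apply (v w : Wreath G m) (i : Fin m) :
    (v * w).left i = v.left i * w.left (v.right⁻¹ i) := rfl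

lemma inv_left_apply (v : Wreath G m) (i : Fin m) :
    (v⁻¹).left i = (v.left (v.right i))⁻¹ := by
  have : v⁻¹.left = (permMulAut G m v.right⁻¹) v.left⁻¹ := rfl
  rw [this]
  change (v.left⁻¹) (v.right⁻¹⁻¹ i) = _
  rw [inv_inv, Pi.inv_apply]

lemma pow_right (w : Wreath G m) (n : ℕ) : (w ^ n).right = w.right ^ n :=
  map_pow SemidirectProduct.rightHom w n

lemma zpow_right (w : Wreath G m) (n : ℤ) : (w ^ n).right = w.right ^ n :=
  map_zpow SemidirectProduct.rightHom w n

lemma inv_self_apply {α : Type*} (f : Perm α) (x : α) : f⁻¹ (f x) = x := f.symm_apply_apply x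

/-- The natural action. -/
def act : Wreath G m →* Perm (Fin m × G) where
  toFun w :=
    { toFun := fun p => (w.right p.1, w.left (w.right p.1) * p.2)
      invFun := fun p => (w.right⁻¹ p.1, (w.left p.1)⁻¹ * p.2)
      left_inv := fun p => by simp
      right_inv := fun p => by simp }
  map_one' := by ext p <;> simp
  map_mul' := fun v w => by
    ext p
    · simp
    · simp [mul_left_apply, mul_assoc]

lemma act_apply (w : Wreath G m) (i : Fin m) (x : G) :
    act w (i, x) = (w.right i, w.left (w.right i) * x) := rfl

lemma act_injective : Injective (act : Wreath G m → Perm (Fin m × G)) := by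
  intro v w h
  have h1 : ∀ i, (v.right i, v.left (v.right i) * 1) = (w.right i, w.left (w.right i) * 1) :=
    fun i => by rw [← act_apply, ← act_apply, h]
  have hr : v.right = w.right := by
    ext i; exact congrArg Fin.val (Prod.ext_iff.1 (h1 i)).1
  have hl : v.left = w.left := by
    funext j
    have := (Prod.ext_iff.1 (h1 (w.right⁻¹ j))).2
    simpa [hr] using this
  exact SemidirectProduct.ext hl hr

/-- Right translation. -/
def rtr : G →* Perm (Fin m × G) where
  toFun a :=
    { toFun := fun p => (p.1, p.2 * a⁻¹)
      invFun := fun p => (p.1, p.2 * a)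
      left_inv := fun p => by simp
      right_inv := fun p => by simp }
  map_one' := by ext p <;> simp
  map_mul' := fun v w => by ext p <;> simp [mul_assoc]

lemma rtr_apply (a : G) (i : Fin m) (x : G) : rtr a (i, x) = (i, x * a⁻¹) := rfl

lemma act_rtr (w : Wreath G m) (a : G) : Commute (act w) (rtr a) := by
  ext p <;> obtain ⟨i, x⟩ := p <;> simp [act_apply, rtr_apply, mul_assoc]

/-- The action of `ℤ × G` attached to `w`. -/
def rho (w : Wreath G m) : Multiplicative ℤ × G →* Perm (Fin m × G) where
  toFun k := act (w ^ (Multiplicative.toAdd k.1)) * rtr k.2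
  map_one' := by simp
  map_mul' := fun k l => by
    simp only [Prod.fst_mul, Prod.snd_mul, toAdd_mul, zpow_add, map_mul]
    have := (act_rtr (w ^ (Multiplicative.toAdd l.1)) k.2).eq
    rw [mul_assoc, mul_assoc, ← mul_assoc _ (rtr k.2) (rtr l.2), this]
    simp only [mul_assoc]

lemma rho_apply (w : Wreath G m) (n : ℤ) (a : G) (i : Fin m) (x : G) :
    rho w (Multiplicative.ofAdd n, a) (i, x) =
      ((w.right ^ n) i, (w ^ n).left ((w.right ^ n) i) * (x * a⁻¹)) := by
  rw [← zpow_right]; rfl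

lemma exists_conj_of_equiv (w w' : Wreath G m) (Φ : Fin m × G ≃ Fin m × G)
    (h : ∀ k z, Φ (rho w k z) = rho w' k (Φ z)) : IsConj w w' := by
  have hR : ∀ i x, Φ (i, x) = ((Φ (i, 1)).1, (Φ (i, 1)).2 * x) := by
    intro i x
    have := h (1, x⁻¹) (i, 1)
    have e1 : ∀ (w : Wreath G m) z, rho w (1, x⁻¹) z = (z.1, z.2 * x) := by
      intro w z
      simp [rho, rtr]
    rw [e1, e1] at this
    simpa using this
  have hs : Surjective (fun i => (Φ (i, 1)).1) := by
    intro j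
    have h1 : Φ (Φ.symm (j, 1)) = (j, 1) := by simp
    generalize Φ.symm (j, 1) = p at h1
    obtain ⟨i, x⟩ := p
    rw [hR] at h1
    exact ⟨i, (Prod.ext_iff.1 h1).1⟩
  let τ : Perm (Fin m) := Equiv.ofBijective _ ⟨Finite.injective_iff_surjective.2 hs, hs⟩
  have hτ : ∀ i, τ i = (Φ (i, 1)).1 := fun i => rfl
  let v : Wreath G m := ⟨fun j => (Φ (τ⁻¹ j, 1)).2, τ⟩
  have hv : ∀ p, act v p = Φ p := by
    rintro ⟨i, x⟩
    rw [hR, act_apply]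
    simp [v, hτ]
    simp [← hτ]
  rw [isConj_iff]
  refine ⟨v, ?_⟩
  rw [mul_inv_eq_iff_eq_mul]
  apply act_injective
  rw [map_mul, map_mul]
  ext1 p
  have e1 : ∀ (w : Wreath G m) z, rho w (Multiplicative.ofAdd 1, 1) z = act w z := by
    intro w z
    simp [rho]
  have := h (Multiplicative.ofAdd 1, 1) p
  rw [e1, e1] at this
  rw [Perm.mul_apply, Perm.mul_apply, hv, hv, this]

/-- Length of the cycle through `i`. -/
noncomputable def per (w : Wreath G m) (i : Fin m) : ℕ := minimalPeriod w.right i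

/-- Cycle product at `i`. -/
noncomputable def cprod (w : Wreath G m) (i : Fin m) : G := (w ^ per w i).left i

lemma zpow_fix_iff (w : Wreath G m) (i : Fin m) (n : ℤ) :
    (w.right ^ n) i = i ↔ (per w i : ℤ) ∣ n :=
  MulAction.zpow_smul_eq_iff_minimalPeriod_dvd (a := w.right) (b := i)

lemma right_pow_per (w : Wreath G m) (i : Fin m) : (w.right ^ per w i) i = i := by
  have := (zpow_fix_iff w i (per w i)).2 dvd_rfl
  simpa using this

lemma per_pos (w : Wreath G m) (i : Fin m) : 0 < per w i := by
  apply Function.minimalPeriod_pos_of_mem_periodicPts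
  exact Function.Injective.mem_periodicPts w.right.injective i

lemma per_le (w : Wreath G m) (i : Fin m) : per w i ≤ m := by
  have := Function.minimalPeriod_le_card (f := w.right) (x := i)
  rw [Fintype.card_fin] at this
  exact this

lemma zpow_left_fix (u : Wreath G m) (i : Fin m) (h : u.right i = i) (q : ℤ) :
    (u ^ q).left i = (u.left i) ^ q := by
  have h' : u.right⁻¹ i = i := by rw [Perm.inv_eq_iff_eq, h]
  induction q using Int.induction_on with
  | zero => simp
  | succ n ih => 
    rw [add_comm, zpow_add, zpow_add, mul_left_apply, zpow_one, h', ih, zpow_one]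
  | pred n ih => 
    rw [sub_eq_neg_add, zpow_add, zpow_add, mul_left_apply, zpow_neg_one, zpow_neg_one, inv_left_apply,
      SemidirectProduct.inv_right, inv_inv, h, ih]

lemma rho_fix_iff (w : Wreath G m) (n : ℤ) (a : G) (i : Fin m) (x : G) :
    rho w (Multiplicative.ofAdd n, a) (i, x) = (i, x) ↔
      ∃ q : ℤ, n = per w i * q ∧ a = (x⁻¹ * cprod w i * x) ^ q := by
  rw [rho_apply, Prod.ext_iff]
  have hz : ∀ q : ℤ, (w ^ (per w i * q : ℤ)).left i = cprod w i ^ q := by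
    intro q
    rw [zpow_mul, zpow_natCast, zpow_left_fix, cprod]
    rw [pow_right, right_pow_per]
  have hc : ∀ q : ℤ, (x⁻¹ * cprod w i * x) ^ q = x⁻¹ * cprod w i ^ q * x := by
    intro q
    have := conj_zpow (i := q) (a := x⁻¹) (b := cprod w i)
    simpa using this
  constructor
  · rintro ⟨h1, h2⟩
    replace h1 : (w.right ^ n) i = i := h1
    obtain ⟨q, rfl⟩ := (zpow_fix_iff w i n).1 h1
    refine ⟨q, rfl, ?_⟩
    replace h2 : _ = x := h2
    rw [h1, hz] at h2
    rw [hc]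
    rw [← mul_assoc, mul_inv_eq_iff_eq_mul] at h2
    rw [mul_assoc, h2]; simp
  · rintro ⟨q, rfl, rfl⟩
    have h1 := (zpow_fix_iff w i _).2 (Dvd.intro q rfl)
    refine ⟨h1, ?_⟩
    simp only [h1, hz, hc]
    group

lemma per_conj (v w : Wreath G m) (i : Fin m) : per (v * w * v⁻¹) (v.right i) = per w i := by
  apply Nat.dvd_antisymm <;> rw [← Int.natCast_dvd_natCast, ← zpow_fix_iff]
  · have : (v * w * v⁻¹).right = v.right * w.right * v.right⁻¹ := rfl
    rw [this, conj_zpow]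
    simp [right_pow_per]
  · have : w.right = v.right⁻¹ * (v * w * v⁻¹).right * v.right⁻¹⁻¹ := by
      simp [mul_assoc]
    rw [this, conj_zpow, inv_inv, Perm.mul_apply, Perm.mul_apply, Perm.inv_eq_iff_eq]
    rw [zpow_natCast, right_pow_per]

lemma cprod_conj (v w : Wreath G m) (i : Fin m) :
    cprod (v * w * v⁻¹) (v.right i) = v.left (v.right i) * cprod w i * (v.left (v.right i))⁻¹ := by
  rw [cprod, per_conj, conj_pow, mul_left_apply, mul_left_apply, inv_left_apply, cprod]
  have h : (w.right ^ per w i)⁻¹ i = i := by rw [Perm.inv_eq_iff_eq, right_pow_per]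
  have h2 : (v * w ^ per w i).right⁻¹ (v.right i) = i := by
    rw [SemidirectProduct.mul_right, mul_inv_rev, pow_right, Perm.mul_apply, inv_self_apply, h]
  rw [h2, inv_self_apply]

/-- Type of a point. -/
noncomputable def typ (w : Wreath G m) (i : Fin m) : Fin m × ConjClasses G :=
  (⟨per w i - 1, by have := per_pos w i; have := per_le w i; omega⟩, ConjClasses.mk (cprod w i))

lemma typ_conj (v w : Wreath G m) (i : Fin m) : typ (v * w * v⁻¹) (v.right i) = typ w i := by
  simp only [typ, per_conj, cprod_conj]
  congr 1
  rw [ConjClasses.mk_eq_mk_iff_isConj, isConj_comm, isConj_iff]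
  exact ⟨_, rfl⟩

lemma typ_right (w : Wreath G m) (i : Fin m) (n : ℤ) : typ w ((w.right ^ n) i) = typ w i := by
  have := typ_conj (w ^ n) w i
  rw [(Commute.zpow_self w n).eq, mul_inv_cancel_right, zpow_right] at this
  exact this

/-- Cycles of `w`. -/
abbrev Cyc (w : Wreath G m) : Type := Quotient (Equiv.Perm.SameCycle.setoid w.right)

/-- Type of a cycle. -/
noncomputable def ctyp (w : Wreath G m) : Cyc w → Fin m × ConjClasses G :=
  Quotient.lift (typ w) (by
    rintro a b ⟨n, rfl⟩
    rw [typ_right])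

lemma ctyp_mk (w : Wreath G m) (i : Fin m) : ctyp w (Quotient.mk _ i) = typ w i := rfl

lemma ctyp_out (w : Wreath G m) (o : Cyc w) : typ w o.out = ctyp w o := by
  rw [← ctyp_mk, Quotient.out_eq]

/-- The number of cycles of each type. -/
noncomputable def cnt (w : Wreath G m) (p : Fin m × ConjClasses G) : ℕ :=
  Nat.card {o : Cyc w // ctyp w o = p}

lemma cnt_conj (v w : Wreath G m) : cnt (v * w * v⁻¹) = cnt w := by
  funext p
  symm
  refine Nat.card_congr (Equiv.subtypeEquiv (Quotient.congr v.right ?_) ?_)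
  · intro a b
    have := (Equiv.Perm.sameCycle_conj (f := w.right) (g := v.right) (x := v.right a)
      (y := v.right b)).symm
    rw [inv_self_apply, inv_self_apply] at this
    exact this
  · intro o
    induction o using Quotient.inductionOn with | _ i => 
    rw [Quotient.congr_mk, ctyp_mk, ctyp_mk, typ_conj]

lemma isConj_of_cnt (w w' : Wreath G m) (h : cnt w = cnt w') : IsConj w w' := by
  have hfib : ∀ p, Nonempty ({o : Cyc w // ctyp w o = p} ≃ {o : Cyc w' // ctyp w' o = p}) :=
    fun p => Finite.card_eq.1 (congrFun h p)
  let b : Cyc w ≃ Cyc w' := (Equiv.sigmaFiberEquiv (ctyp w)).symm.trans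
    ((Equiv.sigmaCongrRight fun p => (hfib p).some).trans (Equiv.sigmaFiberEquiv (ctyp w')))
  have hb : ∀ o, ctyp w' (b o) = ctyp w o := by
    intro o
    exact ((hfib (ctyp w o)).some ⟨o, rfl⟩).2
  have hg : ∀ o : Cyc w, ∃ g : G, g⁻¹ * cprod w' (b o).out * g = cprod w o.out := by
    intro o
    have h1 : typ w o.out = typ w' (b o).out := by rw [ctyp_out, ctyp_out, hb]
    have h2 := (Prod.ext_iff.1 h1).2
    simp only [typ] at h2
    rw [ConjClasses.mk_eq_mk_iff_isConj, isConj_comm, isConj_iff] at h2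
    obtain ⟨c, hc⟩ := h2
    exact ⟨c⁻¹, by simpa using hc⟩
  choose g hg using hg
  have hper : ∀ o : Cyc w, per w' (b o).out = per w o.out := by
    intro o
    have h1 : typ w o.out = typ w' (b o).out := by rw [ctyp_out, ctyp_out, hb]
    have h2 := congrArg Fin.val (Prod.ext_iff.1 h1).1
    simp only [typ] at h2
    have := per_pos w o.out
    have := per_pos w' (b o).out
    omega
  have hcover : ∀ (w : Wreath G m) (o : Cyc w) (y : G) (i : Fin m) (x : G), Quotient.mk _ i = o →
      ∃ k, rho w k (o.out, y) = (i, x) := by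
    intro w o y i x ho
    have : w.right.SameCycle o.out i := by
      rw [← o.out_eq] at ho
      exact (Quotient.exact ho).symm
    obtain ⟨n, hn⟩ := this
    refine ⟨(Multiplicative.ofAdd n, x⁻¹ * (w ^ n).left i * y), ?_⟩
    rw [rho_apply, hn]
    congr 1
    group
  have hsame : ∀ (w : Wreath G m) (o o' : Cyc w) (y y' : G) k, 
      rho w k (o.out, y) = (o'.out, y') → o = o' := by
    rintro w o o' y y' ⟨n, a⟩ hk
    have := (rho_apply w n.toAdd a o.out y).symm.trans hk
    have h1 := (Prod.ext_iff.1 this).1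
    rw [← o.out_eq, ← o'.out_eq]
    exact Quotient.sound ⟨_, h1⟩
  obtain ⟨Φ, hΦ⟩ := exists_equiv (rho w) (rho w') (fun o : Cyc w => (o.out, (1 : G)))
    (fun o => ((b o).out, g o))
    (fun z => ⟨Quotient.mk _ z.1, hcover w _ _ z.1 z.2 rfl⟩)
    (fun i j k hk => hsame w _ _ _ _ k hk)
    (fun z => ⟨b.symm (Quotient.mk _ z.1), by
      simpa using hcover w' (b (b.symm (Quotient.mk _ z.1))) _ z.1 z.2 (by simp)⟩)
    (fun i j k hk => b.injective (hsame w' _ _ _ _ k hk))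
    (by
      rintro o ⟨n, a⟩
      have h1 := rho_fix_iff w n.toAdd a o.out 1
      have h2 := rho_fix_iff w' n.toAdd a (b o).out (g o)
      rw [hg, hper] at h2
      simp only [inv_one, one_mul, mul_one] at h1
      exact h1.trans h2.symm)
  exact exists_conj_of_equiv w w' Φ hΦ

lemma card_cyc (w : Wreath G m) (o : Cyc w) :
    Nat.card {i : Fin m // (Quotient.mk _ i : Cyc w) = o} = ((ctyp w o).1 : ℕ) + 1 := by
  classical
  have h1 : ((ctyp w o).1 : ℕ) + 1 = per w o.out := by
    rw [← ctyp_out]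
    have := per_pos w o.out
    simp only [typ]
    omega
  rw [h1]
  have h2 := MulAction.minimalPeriod_eq_card (a := w.right) (b := o.out)
  rw [← Nat.card_eq_fintype_card] at h2
  refine Eq.trans ?_ h2.symm
  refine Nat.card_congr (Equiv.subtypeEquivRight ?_)
  intro i
  conv_lhs => rw [← o.out_eq]
  constructor
  · intro h
    obtain ⟨n, hn⟩ := (Quotient.exact h).symm
    exact ⟨⟨w.right ^ n, n, rfl⟩, hn⟩
  · rintro ⟨⟨_, n, rfl⟩, hn⟩
    exact (Quotient.sound ⟨n, hn⟩ : (Quotient.mk _ o.out : Cyc w) = Quotient.mk _ i).symm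

lemma sum_cnt [Finite G] (w : Wreath G m) :
    (∑ᶠ p : Fin m × ConjClasses G, ((p.1 : ℕ) + 1) * cnt w p) = m := by
  classical
  have : Fintype (ConjClasses G) := Fintype.ofFinite _
  have : Fintype (Cyc w) := Fintype.ofFinite _
  rw [finsum_eq_sum_of_fintype]
  have e1 : ∀ p, ((p.1 : ℕ) + 1) * cnt w p =
      ∑ o : {o : Cyc w // ctyp w o = p}, (((ctyp w o.1).1 : ℕ) + 1) := by
    intro p
    rw [Finset.sum_congr rfl (g := fun _ => ((p.1 : ℕ) + 1)) (fun o _ => by rw [o.2])]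
    rw [Finset.sum_const, cnt, Nat.card_eq_fintype_card, Finset.card_univ, smul_eq_mul, mul_comm]
  rw [Finset.sum_congr rfl fun p _ => e1 p]
  rw [← Fintype.sum_sigma' (fun p (o : {o : Cyc w // ctyp w o = p}) => (((ctyp w o.1).1 : ℕ) + 1))]
  refine ((Equiv.sigmaFiberEquiv (ctyp w)).sum_comp (fun o => (((ctyp w o).1 : ℕ) + 1))).trans ?_
  simp_rw [← card_cyc]
  rw [← Nat.card_sigma, Nat.card_congr (Equiv.sigmaFiberEquiv _), Nat.card_fin]

lemma exists_cnt [Finite G] (f : Fin m × ConjClasses G → ℕ)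
    (hf : (∑ᶠ p : Fin m × ConjClasses G, ((p.1 : ℕ) + 1) * f p) = m) :
    ∃ w : Wreath G m, cnt w = f := by
  classical
  have : Fintype (ConjClasses G) := Fintype.ofFinite _
  rw [finsum_eq_sum_of_fintype] at hf
  let T := Σ p : Fin m × ConjClasses G, Fin (f p) × ZMod ((p.1 : ℕ) + 1)
  have hT : Nat.card T = Nat.card (Fin m) := by
    rw [Nat.card_fin, ← hf, Nat.card_sigma]
    refine Finset.sum_congr rfl fun p _ => ?_
    rw [Nat.card_prod, Nat.card_fin, Nat.card_zmod, mul_comm]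
  have : Finite T := by
    have : ∀ p : Fin m × ConjClasses G, Finite (Fin (f p) × ZMod ((p.1 : ℕ) + 1)) := by
      intro p; infer_instance
    infer_instance
  obtain ⟨e⟩ := Finite.card_eq.1 hT
  let s : Perm T := Equiv.sigmaCongrRight fun p => (Equiv.refl _).prodCongr (Equiv.addRight 1)
  let σ : Perm (Fin m) := (e.symm.trans s).trans e
  let h : T → G := fun t => if t.2.2 = 0 then t.1.2.out else 1
  let w : Wreath G m := ⟨fun i => h (e.symm i), σ⟩
  have hσ : ∀ p j x, w.right (e ⟨p, j, x⟩) = e ⟨p, j, x + 1⟩ := by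
    intro p j x
    simp only [w, σ, Equiv.trans_apply, Equiv.symm_apply_apply]
    rfl
  have hadj : ∀ p j x y, x = y → e ⟨p, j, x⟩ = e ⟨p, j, y⟩ := by
    rintro p j x _ rfl
    rfl
  have hl : ∀ t, w.left (e t) = h t := by
    intro t
    simp [w]
  have hn : ∀ (n : ℤ) p j x, (w.right ^ n) (e ⟨p, j, x⟩) = e ⟨p, j, x + n⟩ := by
    intro n p j x
    induction n using Int.induction_on with
    | zero => simp
    | succ n ih =>
      rw [add_comm, zpow_add, Perm.mul_apply, ih, zpow_one, hσ]
      apply hadj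
      push_cast
      ring
    | pred n ih =>
      rw [sub_eq_neg_add, zpow_add, Perm.mul_apply, ih, zpow_neg_one, Perm.inv_eq_iff_eq, hσ]
      apply hadj
      push_cast
      ring
  have hper : ∀ p j, per w (e ⟨p, j, 0⟩) = (p.1 : ℕ) + 1 := by
    intro p j
    have key : ∀ n : ℤ, (per w (e ⟨p, j, 0⟩) : ℤ) ∣ n ↔ (((p.1 : ℕ) + 1 : ℕ) : ℤ) ∣ n := by
      intro n
      rw [← zpow_fix_iff, hn, ← ZMod.intCast_zmod_eq_zero_iff_dvd, e.apply_eq_iff_eq, zero_add]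
      constructor
      · intro h0
        have := eq_of_heq (Sigma.mk.inj h0).2
        exact (Prod.ext_iff.1 this).2
      · intro h0
        rw [h0]
    apply Nat.dvd_antisymm
    · exact Int.natCast_dvd_natCast.1 ((key _).2 dvd_rfl)
    · exact Int.natCast_dvd_natCast.1 ((key _).1 dvd_rfl)
  have hact : ∀ p j (n : ℕ), n ≤ (p.1 : ℕ) →
      act (w ^ n) (e ⟨p, j, 0⟩, 1) = (e ⟨p, j, (n : ZMod ((p.1 : ℕ) + 1))⟩, 1) := by
    intro p j n
    induction n with
    | zero => intro _; simp
    | succ n ih =>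
      intro hle
      rw [pow_succ', map_mul, Perm.mul_apply, ih (by omega), act_apply, hσ, hl]
      have : ((n : ZMod ((p.1 : ℕ) + 1)) + 1) ≠ 0 := by
        intro h0
        have : ((n + 1 : ℕ) : ZMod ((p.1 : ℕ) + 1)) = 0 := by push_cast; exact h0
        rw [ZMod.natCast_eq_zero_iff] at this
        have := Nat.le_of_dvd (by omega) this
        omega
      simp [h, this]
  have hcp : ∀ p j, cprod w (e ⟨p, j, 0⟩) = p.2.out := by
    intro p j
    have h1 : act (w ^ ((p.1 : ℕ) + 1)) (e ⟨p, j, 0⟩, 1) = (e ⟨p, j, 0⟩, p.2.out) := by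
      rw [pow_succ', map_mul, Perm.mul_apply, hact p j _ le_rfl, act_apply, hσ, hl]
      have : (((p.1 : ℕ) : ZMod ((p.1 : ℕ) + 1)) + 1) = 0 := by
        exact_mod_cast ZMod.natCast_self ((p.1 : ℕ) + 1)
      simp [h, this]
    have h2 := right_pow_per w (e ⟨p, j, 0⟩)
    rw [hper] at h2
    rw [act_apply, pow_right, h2, mul_one] at h1
    rw [cprod, hper]
    exact (Prod.ext_iff.1 h1).2
  have htyp : ∀ p j, typ w (e ⟨p, j, 0⟩) = p := by
    intro p j
    ext1
    · ext1
      simp [typ, hper]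
    · simp only [typ, hcp]
      exact Quotient.out_eq _
  refine ⟨w, ?_⟩
  let q : (Σ p, Fin (f p)) → Cyc w := fun t => Quotient.mk _ (e ⟨t.1, t.2, 0⟩)
  have hq : Bijective q := by
    constructor
    · rintro ⟨p, j⟩ ⟨p', j'⟩ hpj
      obtain ⟨n, hn'⟩ := Quotient.exact hpj
      rw [hn, e.apply_eq_iff_eq] at hn'
      have := congrArg (fun t : T => (⟨t.1, t.2.1⟩ : Σ p, Fin (f p))) hn'
      exact this
    · intro o
      induction o using Quotient.inductionOn with | _ i =>
      obtain ⟨⟨p, j, x⟩, rfl⟩ := e.surjective i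
      refine ⟨⟨p, j⟩, Quotient.sound ⟨(x.val : ℤ), ?_⟩⟩
      rw [hn]
      simp
  funext p
  have E : {t : Σ p, Fin (f p) // t.1 = p} ≃ {o : Cyc w // ctyp w o = p} :=
    Equiv.subtypeEquiv (Equiv.ofBijective q hq) (by
      rintro ⟨p', j⟩
      change p' = p ↔ ctyp w (Quotient.mk _ (e ⟨p', j, 0⟩)) = p
      rw [ctyp_mk, htyp])
  have E' : Fin (f p) ≃ {t : Σ p, Fin (f p) // t.1 = p} :=
    { toFun := fun j => ⟨⟨p, j⟩, rfl⟩
      invFun := fun t => t.2 ▸ t.1.2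
      left_inv := fun j => rfl
      right_inv := by rintro ⟨⟨p, j⟩, rfl⟩; rfl }
  rw [cnt, ← Nat.card_congr E, ← Nat.card_congr E', Nat.card_fin]

end WreathAux

/-- The number of conjugacy classes of the wreath product `G ≀ S_m` (for `G` a finite
group) equals the number of functions `f : {1, …, m} × ConjClasses G → ℕ` (indexed here
by `Fin m × ConjClasses G`, with `k : Fin m` standing for `k + 1 ∈ {1, …, m}`) such that
`Σ_{(k,c)} k · f (k, c) = m`. -/
theorem card_conjClasses_wreath (G : Type*) [Group G] [Finite G] (m : ℕ) (hm : 1 ≤ m) :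
    Nat.card (ConjClasses (Wreath G m)) =
      Nat.card {f : Fin m × ConjClasses G → ℕ //
        (∑ᶠ p : Fin m × ConjClasses G, ((p.1 : ℕ) + 1) * f p) = m} := by
  let F : ConjClasses (Wreath G m) → {f : Fin m × ConjClasses G → ℕ //
        (∑ᶠ p : Fin m × ConjClasses G, ((p.1 : ℕ) + 1) * f p) = m} :=
    Quotient.lift (fun w => ⟨WreathAux.cnt w, WreathAux.sum_cnt w⟩) (by
      intro a b hab
      obtain ⟨c, rfl⟩ := isConj_iff.1 hab
      exact Subtype.ext (WreathAux.cnt_conj c a).symm)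
  refine Nat.card_congr (Equiv.ofBijective F ⟨?_, ?_⟩)
  · intro a b hab
    induction a using Quotient.inductionOn with | _ a =>
    induction b using Quotient.inductionOn with | _ b =>
    exact Quotient.sound (WreathAux.isConj_of_cnt a b (congrArg Subtype.val hab))
  · rintro ⟨f, hf⟩
    obtain ⟨w, hw⟩ := WreathAux.exists_cnt f hf
    exact ⟨ConjClasses.mk w, Subtype.ext hw⟩
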